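/- arXiv:2410.22460 — 4 statements merged into one kernel-verified Lean document; each statement's English description precedes it below -/
import Mathlib

section
/- Any two distinct transactions assigned the same bin number do not conflict: if i ≠ j and bin i = bin j, then T_i and T_j are non-conflicting. Hence each bin consists of pairwise non-conflicting transactions. -/
/-- A transaction modeled by a finite read set and a finite write set of addresses. -/
structure Txn (α : Type*) where
  reads : Finset α
  writes : Finset α

/-- Transactions `A` and `B` conflict if some data item is written by both,
or read by one and written by the other. -/
def Conflict {α : Type*} (A B : Txn α) : Prop :=
  (∃ a, a ∈ A.writes ∧ a ∈ B.writes) ∨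
    (∃ a, a ∈ A.reads ∧ a ∈ B.writes) ∨
    (∃ a, a ∈ A.writes ∧ a ∈ B.reads)

/-- `bin` satisfies the CalculateBin recursion: `bin i = 0` if no `j < i` conflicts
with `T i`, and otherwise `bin i = 1 + max {bin j : j < i and T j conflicts with T i}`. -/
def BinSpec {α : Type*} {n : ℕ} (T : Fin n → Txn α) (bin : Fin n → ℕ) : Prop :=
  ∀ i : Fin n,
    ((¬ ∃ j : Fin n, j < i ∧ Conflict (T j) (T i)) → bin i = 0) ∧
    ((∃ j : Fin n, j < i ∧ Conflict (T j) (T i)) →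
      bin i = 1 + sSup (bin '' {j : Fin n | j < i ∧ Conflict (T j) (T i)}))

theorem Conflict.symm {α : Type*} {A B : Txn α} (h : Conflict A B) : Conflict B A := by
  rcases h with ⟨a, ha, hb⟩ | ⟨a, ha, hb⟩ | ⟨a, ha, hb⟩
  · exact Or.inl ⟨a, hb, ha⟩
  · exact Or.inr (Or.inr ⟨a, hb, ha⟩)
  · exact Or.inr (Or.inl ⟨a, hb, ha⟩)

theorem BinSpec.lt_of_conflict {α : Type*} {n : ℕ} {T : Fin n → Txn α} {bin : Fin n → ℕ}
    (hbin : BinSpec T bin) {i j : Fin n} (hij : i < j) (h : Conflict (T i) (T j)) :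
    bin i < bin j := by
  have hle : bin i ≤ sSup (bin '' {k : Fin n | k < j ∧ Conflict (T k) (T j)}) :=
    le_csSup ((Set.toFinite _).image bin).bddAbove ⟨i, ⟨hij, h⟩, rfl⟩
  have heq := (hbin j).2 ⟨i, hij, h⟩
  omega

/-- Any two distinct transactions assigned the same bin number do not conflict:
each bin consists of pairwise non-conflicting transactions. -/
theorem not_conflict_of_bin_eq {α : Type*} {n : ℕ} (T : Fin n → Txn α) (bin : Fin n → ℕ)
    (hbin : BinSpec T bin) :
    ∀ i j : Fin n, i ≠ j → bin i = bin j → ¬ Conflict (T i) (T j) := by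
  intro i j hne heq h
  rcases lt_or_gt_of_ne hne with hij | hji
  · exact (hbin.lt_of_conflict hij h).ne heq
  · exact (hbin.lt_of_conflict hji h.symm).ne heq.symm
end

section
/- For every index i, bin i equals the maximum length k of a conflict chain ending at i, i.e., the largest k for which there exist indices j_0 < j_1 < ⋯ < j_k = i such that T_{j_t} and T_{j_{t+1}} conflict for every t < k. -/
/-- A conflict chain ending at `i` of length `k`: indices `j₀ < j₁ < ⋯ < j_k = i`
with `T j_t` and `T j_{t+1}` conflicting for every `t < k`. -/
def ConflictChainTo {α : Type*} {n : ℕ} (T : Fin n → Txn α) (i : Fin n) (k : ℕ) : Prop :=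
  ∃ c : Fin (k + 1) → Fin n, StrictMono c ∧ c (Fin.last k) = i ∧
    ∀ t : Fin k, Conflict (T (c t.castSucc)) (T (c t.succ))

namespace ConflictChainTo

variable {α : Type*} {n : ℕ} {T : Fin n → Txn α} {i j : Fin n} {k : ℕ}

theorem zero (T : Fin n → Txn α) (i : Fin n) : ConflictChainTo T i 0 :=
  ⟨fun _ => i, Subsingleton.strictMono (α := Fin 1) _, rfl, fun t => t.elim0⟩

/-- A chain ending at `j` extends to any later `i` conflicting with `j`. -/
theorem snoc (h : ConflictChainTo T j k) (hji : j < i) (hc : Conflict (T j) (T i)) :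
    ConflictChainTo T i (k + 1) := by
  obtain ⟨c, hmono, rfl, hconf⟩ := h
  refine ⟨Fin.snoc (α := fun _ => Fin n) c i, Fin.strictMono_iff_lt_succ.2 fun t => ?_,
    Fin.snoc_last .., fun t => ?_⟩
  · induction t using Fin.lastCases with
    | last => simpa only [Fin.snoc_castSucc, Fin.succ_last, Fin.snoc_last] using hji
    | cast t =>
      simpa only [Fin.snoc_castSucc, Fin.succ_castSucc] using hmono t.castSucc_lt_succ
  · induction t using Fin.lastCases with
    | last => simpa only [Fin.snoc_castSucc, Fin.succ_last, Fin.snoc_last] using hc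
    | cast t => simpa only [Fin.snoc_castSucc, Fin.succ_castSucc] using hconf t

/-- Dropping the last index of a nontrivial chain leaves a chain ending at its predecessor. -/
theorem exists_pred (h : ConflictChainTo T i (k + 1)) :
    ∃ j, j < i ∧ Conflict (T j) (T i) ∧ ConflictChainTo T j k := by
  obtain ⟨c, hmono, rfl, hconf⟩ := h
  exact ⟨c (Fin.last k).castSucc, hmono (Fin.castSucc_lt_last _), hconf (Fin.last k),
    c ∘ Fin.castSucc, hmono.comp Fin.strictMono_castSucc, rfl, fun t => hconf t.castSucc⟩

end ConflictChainTo

/-- `bin i` equals the maximum length of a conflict chain ending at `i`. -/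
theorem bin_eq_max_chain_length {α : Type*} {n : ℕ} (T : Fin n → Txn α) (bin : Fin n → ℕ)
    (hbin : BinSpec T bin) :
    ∀ i : Fin n, IsGreatest {k : ℕ | ConflictChainTo T i k} (bin i) := by
  intro i
  induction i using WellFoundedLT.induction with
  | ind i ih =>
    have hbdd : BddAbove (bin '' {j : Fin n | j < i ∧ Conflict (T j) (T i)}) :=
      (Set.toFinite _).bddAbove
    constructor
    · by_cases h : ∃ j : Fin n, j < i ∧ Conflict (T j) (T i)
      · have hne : {j : Fin n | j < i ∧ Conflict (T j) (T i)}.Nonempty := h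
        obtain ⟨j, ⟨hji, hc⟩, hj⟩ := Nat.sSup_mem (hne.image bin) hbdd
        rw [(hbin i).2 h, ← hj, add_comm]
        exact (ih j hji).1.snoc hji hc
      · rw [(hbin i).1 h]
        exact ConflictChainTo.zero T i
    · rintro (_ | k) hk
      · exact Nat.zero_le _
      · obtain ⟨j, hji, hc, hj⟩ := ConflictChainTo.exists_pred hk
        rw [(hbin i).2 ⟨j, hji, hc⟩, add_comm k]
        exact Nat.add_le_add_left
          (((ih j hji).2 hj).trans (le_csSup hbdd (Set.mem_image_of_mem bin ⟨hji, hc⟩))) 1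
end

section
/- The greedy bin assignment is pointwise minimal: if b : Fin n → ℕ is any function satisfying b j < b i whenever j < i and T_j conflicts with T_i, then bin i ≤ b i for every i. In particular, the number of bins used by the greedy assignment is minimal among all assignments that place earlier conflicting transactions in strictly lower bins. -/
/-- The greedy bin assignment is pointwise minimal among all assignments that place
earlier conflicting transactions in strictly lower bins. -/
theorem bin_pointwise_minimal {α : Type*} {n : ℕ} (T : Fin n → Txn α) (bin : Fin n → ℕ)
    (hbin : BinSpec T bin) (b : Fin n → ℕ)
    (hb : ∀ i j : Fin n, j < i → Conflict (T j) (T i) → b j < b i) :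
    ∀ i : Fin n, bin i ≤ b i := by
  intro i
  induction i using WellFoundedLT.induction with
  | ind i ih =>
    by_cases h : ∃ j : Fin n, j < i ∧ Conflict (T j) (T i)
    · rw [(hbin i).2 h, Nat.add_comm, Nat.succ_le_iff]
      have hne : (bin '' {j : Fin n | j < i ∧ Conflict (T j) (T i)}).Nonempty :=
        Set.Nonempty.image bin h
      obtain ⟨j, ⟨hji, hc⟩, hj⟩ := Nat.sSup_mem hne (Set.toFinite _).bddAbove
      rw [← hj]
      exact (ih j hji).trans_lt (hb i j hji hc)
    · simp [(hbin i).1 h]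
end

section
/- The largest bin number assigned, max over i of bin i, equals the maximum length of any conflict chain among the transactions; hence the total number of bins equals one plus the length of the longest conflict chain. -/
/-- A conflict chain of length `k`: indices `j₀ < j₁ < ⋯ < j_k` with `T j_t` and
`T j_{t+1}` conflicting for every `t < k`. -/
def ConflictChain {α : Type*} {n : ℕ} (T : Fin n → Txn α) (k : ℕ) : Prop :=
  ∃ c : Fin (k + 1) → Fin n, StrictMono c ∧
    ∀ t : Fin k, Conflict (T (c t.castSucc)) (T (c t.succ))

namespace BinSpec

variable {α : Type*} {n : ℕ} {T : Fin n → Txn α} {bin : Fin n → ℕ}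

theorem lt_of_conflict_s10 (hbin : BinSpec T bin) {i j : Fin n} (hji : j < i)
    (hc : Conflict (T j) (T i)) : bin j < bin i := by
  have h := (hbin i).2 ⟨j, hji, hc⟩
  have hle : bin j ≤ sSup (bin '' {j : Fin n | j < i ∧ Conflict (T j) (T i)}) :=
    le_csSup (Set.toFinite _).bddAbove ⟨j, ⟨hji, hc⟩, rfl⟩
  omega

theorem exists_conflict_of_eq_succ (hbin : BinSpec T bin) {i : Fin n} {k : ℕ}
    (hi : bin i = k + 1) : ∃ j < i, Conflict (T j) (T i) ∧ bin j = k := by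
  have hex : ∃ j : Fin n, j < i ∧ Conflict (T j) (T i) := by
    by_contra h
    have := (hbin i).1 h
    omega
  have h := (hbin i).2 hex
  have hne : (bin '' {j : Fin n | j < i ∧ Conflict (T j) (T i)}).Nonempty :=
    Set.Nonempty.image bin hex
  obtain ⟨j, ⟨hji, hc⟩, hj⟩ := Nat.sSup_mem hne (Set.toFinite _).bddAbove
  exact ⟨j, hji, hc, by omega⟩

/-- Every transaction ends a conflict chain that visits the bins `0, 1, …` in order. -/
theorem exists_chain_to (hbin : BinSpec T bin) (k : ℕ) (i : Fin n) (hi : bin i = k) :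
    ∃ c : Fin (k + 1) → Fin n, StrictMono c ∧
      (∀ t : Fin k, Conflict (T (c t.castSucc)) (T (c t.succ))) ∧
      c (Fin.last k) = i ∧ ∀ t, bin (c t) = t := by
  induction k generalizing i with
  | zero =>
    refine ⟨fun _ => i, Fin.strictMono_iff_lt_succ.2 fun t => t.elim0,
      fun t => t.elim0, rfl, fun t => ?_⟩
    rw [hi, Fin.val_eq_zero]
  | succ k ih =>
    obtain ⟨j, hji, hc, hj⟩ := hbin.exists_conflict_of_eq_succ hi
    obtain ⟨c, hmono, hconf, hlast, hval⟩ := ih j hj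
    refine ⟨Fin.snoc (α := fun _ => Fin n) c i, Fin.strictMono_iff_lt_succ.2 fun t => ?_,
      fun t => ?_, Fin.snoc_last _ _, fun t => ?_⟩
    · induction t using Fin.lastCases with
      | last => simpa [hlast] using hji
      | cast t =>
        rw [Fin.succ_castSucc, Fin.snoc_castSucc, Fin.snoc_castSucc]
        exact hmono Fin.castSucc_lt_succ
    · induction t using Fin.lastCases with
      | last => simpa [hlast] using hc
      | cast t =>
        rw [Fin.succ_castSucc, Fin.snoc_castSucc, Fin.snoc_castSucc]
        exact hconf t
    · induction t using Fin.lastCases with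
      | last => simpa using hi
      | cast t => simpa using hval t

theorem le_bin_of_chain (hbin : BinSpec T bin) {k : ℕ} {c : Fin (k + 1) → Fin n}
    (hmono : StrictMono c) (hconf : ∀ t : Fin k, Conflict (T (c t.castSucc)) (T (c t.succ)))
    (t : Fin (k + 1)) : (t : ℕ) ≤ bin (c t) := by
  induction t using Fin.induction with
  | zero => simp
  | succ t ih =>
    have := hbin.lt_of_conflict_s10 (hmono (Fin.castSucc_lt_succ (i := t))) (hconf t)
    simp only [Fin.val_castSucc, Fin.val_succ] at ih ⊢
    omega

end BinSpec

/-- The largest assigned bin number equals the maximum length of any conflict chain;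
hence the total number of bins equals one plus the length of the longest conflict chain. -/
theorem max_bin_eq_longest_chain {α : Type*} {n : ℕ} (hn : 1 ≤ n) (T : Fin n → Txn α)
    (bin : Fin n → ℕ) (hbin : BinSpec T bin) :
    IsGreatest {k : ℕ | ConflictChain T k} (Finset.univ.sup bin) ∧
    (Finset.univ.image bin).card = 1 + Finset.univ.sup bin := by
  have : Nonempty (Fin n) := ⟨⟨0, hn⟩⟩
  obtain ⟨i, -, hi⟩ := Finset.exists_mem_eq_sup Finset.univ Finset.univ_nonempty bin
  obtain ⟨c, hmono, hconf, -, hval⟩ := hbin.exists_chain_to _ i hi.symm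
  refine ⟨⟨⟨c, hmono, hconf⟩, ?_⟩, ?_⟩
  · rintro k ⟨d, hd, hdconf⟩
    exact (hbin.le_bin_of_chain hd hdconf (Fin.last k)).trans
      (Finset.le_sup (Finset.mem_univ _))
  · have himage : Finset.univ.image bin = Finset.range (1 + Finset.univ.sup bin) := by
      ext m
      simp only [Finset.mem_image, Finset.mem_univ, true_and, Finset.mem_range]
      constructor
      · rintro ⟨j, rfl⟩
        have : bin j ≤ Finset.univ.sup bin := Finset.le_sup (Finset.mem_univ j)
        omega
      · intro hm
        exact ⟨c ⟨m, by omega⟩, hval _⟩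
    rw [himage, Finset.card_range]
end
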